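/- (Corollary.) thm(C_prec) = thm(C_rec): for every sentence A of arithmetic, there exists a ∈ C_prec with End(a) = {A} if and only if there exists a ∈ C_rec with End(a) = {A}. -/

import Mathlib

namespace Shoen

/-- Kleene application: value of the `e`-th partial recursive function at `n`,
in the standard numbering via `Nat.Partrec.Code`. -/
def peval (e n : ℕ) : Part ℕ := (Denumerable.ofNat Nat.Partrec.Code e).eval n

/-- `e` is an index of a (total) primitive recursive function. -/
def PrimIndex (e : ℕ) : Prop := ∃ f : ℕ → ℕ, Nat.Primrec f ∧ ∀ n, peval e n = Part.some (f n)

/-- Kleene's relation `<_O`. -/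
inductive KLt : ℕ → ℕ → Prop
  | base : KLt 1 2
  | step {a b : ℕ} : KLt a b → KLt b (2 ^ b)
  | lim {e : ℕ} (h : ∀ n, (peval e n).Dom)
      (hm : ∀ n, KLt ((peval e n).get (h n)) ((peval e (n + 1)).get (h (n + 1))))
      (n : ℕ) : KLt ((peval e n).get (h n)) (3 * 5 ^ e)
  | trans {a b c : ℕ} : KLt a b → KLt b c → KLt a c

/-- Kleene's `O`. -/
def KO (a : ℕ) : Prop := KLt a (2 ^ a)

/-- The auxiliary relation `<'_O`. -/
inductive KLt' : ℕ → ℕ → Prop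
  | base : KLt' 1 2
  | step {a b : ℕ} : KLt' a b → KLt' b (2 ^ b)
  | lim {e n x : ℕ} : x ∈ peval e n → KLt' x (3 * 5 ^ e)
  | trans {a b c : ℕ} : KLt' a b → KLt' b c → KLt' a c

/-- The inductive characterization `O'` of Kleene's `O`. -/
inductive KO' : ℕ → Prop
  | one : KO' 1
  | step {a : ℕ} : KO' a → KO' (2 ^ a)
  | lim {e : ℕ} (h : ∀ n, (peval e n).Dom)
      (hm : ∀ n, KLt' ((peval e n).get (h n)) ((peval e (n + 1)).get (h (n + 1)))) :
      KO' (3 * 5 ^ e)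



/-! ### Syntax of first order arithmetic (negation normal form) -/

/-- Terms of the language `0,1,+,×,=`, with de Bruijn variables. -/
inductive Trm : Type
  | var : ℕ → Trm
  | zero : Trm
  | one : Trm
  | add : Trm → Trm → Trm
  | mul : Trm → Trm → Trm
deriving DecidableEq

/-- Formulas in negation normal form: literals (atomic and negated atomic
formulas) combined by `∧, ∨, ∀, ∃` (de Bruijn binders). -/
inductive Fml : Type
  | eq : Trm → Trm → Fml
  | ne : Trm → Trm → Fml
  | and : Fml → Fml → Fml
  | or : Fml → Fml → Fml
  | all : Fml → Fml
  | ex : Fml → Fml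
deriving DecidableEq

/-- All free variables of a term are `< k`. -/
def Trm.cu : Trm → ℕ → Bool
  | .var i, k => decide (i < k)
  | .zero, _ => true
  | .one, _ => true
  | .add s t, k => s.cu k && t.cu k
  | .mul s t, k => s.cu k && t.cu k

/-- All free variables of a formula are `< k`. -/
def Fml.cu : Fml → ℕ → Bool
  | .eq s t, k => s.cu k && t.cu k
  | .ne s t, k => s.cu k && t.cu k
  | .and A B, k => A.cu k && B.cu k
  | .or A B, k => A.cu k && B.cu k
  | .all A, k => A.cu (k + 1)
  | .ex A, k => A.cu (k + 1)

/-- A sentence is a closed formula. -/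
abbrev Sentence : Type := { A : Fml // A.cu 0 = true }

/-- Value of a term under an environment. -/
def Trm.val (ρ : ℕ → ℕ) : Trm → ℕ
  | .var i => ρ i
  | .zero => 0
  | .one => 1
  | .add s t => s.val ρ + t.val ρ
  | .mul s t => s.val ρ * t.val ρ

/-- Extend an environment by a value for variable `0`. -/
def consEnv (n : ℕ) (ρ : ℕ → ℕ) : ℕ → ℕ
  | 0 => n
  | k + 1 => ρ k

/-- Satisfaction in the standard model `ℕ`. -/
def Fml.Sat (ρ : ℕ → ℕ) : Fml → Prop
  | .eq s t => s.val ρ = t.val ρ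
  | .ne s t => s.val ρ ≠ t.val ρ
  | .and A B => A.Sat ρ ∧ B.Sat ρ
  | .or A B => A.Sat ρ ∨ B.Sat ρ
  | .all A => ∀ n : ℕ, A.Sat (consEnv n ρ)
  | .ex A => ∃ n : ℕ, A.Sat (consEnv n ρ)

/-- Truth of a sentence in the standard model. -/
def sentTrue (A : Sentence) : Prop := A.1.Sat (fun _ => 0)

/-- Substitution of a closed term `t` for variable `k` in a term. -/
def Trm.sub (t : Trm) (k : ℕ) : Trm → Trm
  | .var i => if i = k then t else if k < i then .var (i - 1) else .var i
  | .zero => .zero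
  | .one => .one
  | .add s u => .add (Trm.sub t k s) (Trm.sub t k u)
  | .mul s u => .mul (Trm.sub t k s) (Trm.sub t k u)

/-- Substitution of a closed term `t` for variable `k` in a formula. -/
def Fml.sub (t : Trm) : Fml → ℕ → Fml
  | .eq s u, k => .eq (Trm.sub t k s) (Trm.sub t k u)
  | .ne s u, k => .ne (Trm.sub t k s) (Trm.sub t k u)
  | .and A B, k => .and (A.sub t k) (B.sub t k)
  | .or A B, k => .or (A.sub t k) (B.sub t k)
  | .all A, k => .all (A.sub t (k + 1))
  | .ex A, k => .ex (A.sub t (k + 1))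

/-- The numeral `n̄`. -/
def numeral : ℕ → Trm
  | 0 => .zero
  | n + 1 => .add (numeral n) .one

theorem Trm.cu_mono : ∀ (t : Trm) {j k : ℕ}, j ≤ k → t.cu j = true → t.cu k = true := by
  intro t
  induction t with
  | var i =>
    intro j k h ht
    simp only [Trm.cu, decide_eq_true_eq] at *
    omega
  | zero => intros; rfl
  | one => intros; rfl
  | add s u ihs ihu =>
    intro j k h ht
    simp only [Trm.cu, Bool.and_eq_true] at *
    exact ⟨ihs h ht.1, ihu h ht.2⟩
  | mul s u ihs ihu =>
    intro j k h ht
    simp only [Trm.cu, Bool.and_eq_true] at *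
    exact ⟨ihs h ht.1, ihu h ht.2⟩

theorem Trm.cu_sub : ∀ (s : Trm) {k : ℕ} {t : Trm},
    t.cu 0 = true → s.cu (k + 1) = true → (Trm.sub t k s).cu k = true := by
  intro s
  induction s with
  | var i =>
    intro k t ht hs
    simp only [Trm.cu, decide_eq_true_eq] at hs
    simp only [Trm.sub]
    by_cases h : i = k
    · rw [if_pos h]
      exact Trm.cu_mono t (Nat.zero_le k) ht
    · have h2 : ¬ k < i := by omega
      rw [if_neg h, if_neg h2]
      simp only [Trm.cu, decide_eq_true_eq]
      omega
  | zero => intros; rfl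
  | one => intros; rfl
  | add s u ihs ihu =>
    intro k t ht hs
    simp only [Trm.cu, Bool.and_eq_true] at hs
    simp only [Trm.sub, Trm.cu, Bool.and_eq_true]
    exact ⟨ihs ht hs.1, ihu ht hs.2⟩
  | mul s u ihs ihu =>
    intro k t ht hs
    simp only [Trm.cu, Bool.and_eq_true] at hs
    simp only [Trm.sub, Trm.cu, Bool.and_eq_true]
    exact ⟨ihs ht hs.1, ihu ht hs.2⟩

theorem Fml.cu_sub : ∀ (A : Fml) {k : ℕ} {t : Trm},
    t.cu 0 = true → A.cu (k + 1) = true → (A.sub t k).cu k = true := by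
  intro A
  induction A with
  | eq s u =>
    intro k t ht hA
    simp only [Fml.cu, Bool.and_eq_true] at hA
    simp only [Fml.sub, Fml.cu, Bool.and_eq_true]
    exact ⟨Trm.cu_sub s ht hA.1, Trm.cu_sub u ht hA.2⟩
  | ne s u =>
    intro k t ht hA
    simp only [Fml.cu, Bool.and_eq_true] at hA
    simp only [Fml.sub, Fml.cu, Bool.and_eq_true]
    exact ⟨Trm.cu_sub s ht hA.1, Trm.cu_sub u ht hA.2⟩
  | and A B ihA ihB =>
    intro k t ht h
    simp only [Fml.cu, Bool.and_eq_true] at h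
    simp only [Fml.sub, Fml.cu, Bool.and_eq_true]
    exact ⟨ihA ht h.1, ihB ht h.2⟩
  | or A B ihA ihB =>
    intro k t ht h
    simp only [Fml.cu, Bool.and_eq_true] at h
    simp only [Fml.sub, Fml.cu, Bool.and_eq_true]
    exact ⟨ihA ht h.1, ihB ht h.2⟩
  | all A ihA =>
    intro k t ht h
    simp only [Fml.cu] at h
    simp only [Fml.sub, Fml.cu]
    exact ihA ht h
  | ex A ihA =>
    intro k t ht h
    simp only [Fml.cu] at h
    simp only [Fml.sub, Fml.cu]
    exact ihA ht h

theorem numeral_cu : ∀ n : ℕ, (numeral n).cu 0 = true := by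
  intro n
  induction n with
  | zero => rfl
  | succ n ih => simp [numeral, Trm.cu, ih]

/-- Negation (de Morgan dual) of a formula in negation normal form. -/
def Fml.neg : Fml → Fml
  | .eq s t => .ne s t
  | .ne s t => .eq s t
  | .and A B => .or A.neg B.neg
  | .or A B => .and A.neg B.neg
  | .all A => .ex A.neg
  | .ex A => .all A.neg

theorem Fml.cu_neg : ∀ (A : Fml) {k : ℕ}, A.cu k = true → A.neg.cu k = true := by
  intro A
  induction A with
  | eq s u => intro k h; simpa [Fml.cu, Fml.neg] using h
  | ne s u => intro k h; simpa [Fml.cu, Fml.neg] using h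
  | and A B ihA ihB =>
    intro k h
    simp only [Fml.cu, Bool.and_eq_true] at h
    simp only [Fml.neg, Fml.cu, Bool.and_eq_true]
    exact ⟨ihA h.1, ihB h.2⟩
  | or A B ihA ihB =>
    intro k h
    simp only [Fml.cu, Bool.and_eq_true] at h
    simp only [Fml.neg, Fml.cu, Bool.and_eq_true]
    exact ⟨ihA h.1, ihB h.2⟩
  | all A ihA =>
    intro k h
    simp only [Fml.cu] at h
    simp only [Fml.neg, Fml.cu]
    exact ihA h
  | ex A ihA =>
    intro k h
    simp only [Fml.cu] at h
    simp only [Fml.neg, Fml.cu]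
    exact ihA h

/-- Conjunction of sentences. -/
def sAnd (A B : Sentence) : Sentence :=
  ⟨.and A.1 B.1, by simp [Fml.cu, A.2, B.2]⟩

/-- Disjunction of sentences. -/
def sOr (A B : Sentence) : Sentence :=
  ⟨.or A.1 B.1, by simp [Fml.cu, A.2, B.2]⟩

/-- Negation of a sentence. -/
def sNeg (A : Sentence) : Sentence := ⟨A.1.neg, Fml.cu_neg A.1 A.2⟩

/-- The sentence `∀x A(x)`, for `A` with (at most) one free variable. -/
def sAll (A : Fml) (h : A.cu 1 = true) : Sentence := ⟨.all A, by simpa [Fml.cu] using h⟩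

/-- The sentence `∃x A(x)`, for `A` with (at most) one free variable. -/
def sEx (A : Fml) (h : A.cu 1 = true) : Sentence := ⟨.ex A, by simpa [Fml.cu] using h⟩

/-- The instance `A(n̄)` of a formula `A` with one free variable. -/
def sInst (A : Fml) (h : A.cu 1 = true) (n : ℕ) : Sentence :=
  ⟨A.sub (numeral n) 0, Fml.cu_sub A (numeral_cu n) h⟩

/-- Literals: atomic and negated atomic formulas. -/
def Fml.isLiteral : Fml → Bool
  | .eq _ _ => true
  | .ne _ _ => true
  | _ => false

/-- Quantifier free formulas. -/
def Fml.qf : Fml → Bool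
  | .eq _ _ => true
  | .ne _ _ => true
  | .and A B => A.qf && B.qf
  | .or A B => A.qf && B.qf
  | .all _ => false
  | .ex _ => false

/-- An axiom is a sequent containing a true closed literal. -/
def IsAxiom (Γ : Finset Sentence) : Prop :=
  ∃ A ∈ Γ, A.1.isLiteral = true ∧ sentTrue A

/-- A sequent is true if some member is true. -/
def SeqTrue (Γ : Finset Sentence) : Prop := ∃ A ∈ Γ, sentTrue A


/-! ### A primitive recursive Gödel numbering of terms, sentences and sequents -/

/-- Gödel number of a term. -/
def Trm.enc : Trm → ℕ
  | .var i => 5 * i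
  | .zero => 1
  | .one => 2
  | .add s t => 5 * Nat.pair s.enc t.enc + 3
  | .mul s t => 5 * Nat.pair s.enc t.enc + 4

/-- Fuelled decoding of terms. -/
def Trm.dec : ℕ → ℕ → Option Trm
  | 0, _ => none
  | fuel + 1, n =>
    if n % 5 = 0 then some (.var (n / 5))
    else if n % 5 = 1 then some .zero
    else if n % 5 = 2 then some .one
    else if n % 5 = 3 then
      match Trm.dec fuel (n / 5).unpair.1, Trm.dec fuel (n / 5).unpair.2 with
      | some s, some t => some (.add s t)
      | _, _ => none
    else
      match Trm.dec fuel (n / 5).unpair.1, Trm.dec fuel (n / 5).unpair.2 with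
      | some s, some t => some (.mul s t)
      | _, _ => none

theorem Trm.dec_enc : ∀ (t : Trm) (fuel : ℕ), t.enc < fuel → Trm.dec fuel t.enc = some t := by
  intro t
  induction t with
  | var i =>
    intro fuel h
    match fuel with
    | f + 1 =>
      have h0 : (5 * i) % 5 = 0 := by omega
      have h1 : (5 * i) / 5 = i := by omega
      simp [Trm.dec, Trm.enc, h0, h1]
  | zero =>
    intro fuel h
    match fuel with
    | f + 1 => simp [Trm.dec, Trm.enc]
  | one =>
    intro fuel h
    match fuel with
    | f + 1 => simp [Trm.dec, Trm.enc]
  | add s u ihs ihu =>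
    intro fuel h
    match fuel with
    | f + 1 =>
      simp only [Trm.enc] at h ⊢
      set p := Nat.pair s.enc u.enc with hp
      have h0 : (5 * p + 3) % 5 = 3 := by omega
      have h1 : (5 * p + 3) / 5 = p := by omega
      have hs : s.enc < f := by
        have := Nat.left_le_pair s.enc u.enc
        omega
      have hu : u.enc < f := by
        have := Nat.right_le_pair s.enc u.enc
        omega
      simp only [Trm.dec, h0, h1]
      rw [hp, Nat.unpair_pair, ihs f hs, ihu f hu]
      simp
  | mul s u ihs ihu =>
    intro fuel h
    match fuel with
    | f + 1 =>
      simp only [Trm.enc] at h ⊢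
      set p := Nat.pair s.enc u.enc with hp
      have h0 : (5 * p + 4) % 5 = 4 := by omega
      have h1 : (5 * p + 4) / 5 = p := by omega
      have hs : s.enc < f := by
        have := Nat.left_le_pair s.enc u.enc
        omega
      have hu : u.enc < f := by
        have := Nat.right_le_pair s.enc u.enc
        omega
      simp only [Trm.dec, h0, h1]
      rw [hp, Nat.unpair_pair, ihs f hs, ihu f hu]
      simp

instance : Encodable Trm :=
  ⟨Trm.enc, fun n => Trm.dec (n + 1) n, fun t => Trm.dec_enc t _ (Nat.lt_succ_self _)⟩

/-- Gödel number of a formula. -/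
def Fml.enc : Fml → ℕ
  | .eq s t => 6 * Nat.pair s.enc t.enc
  | .ne s t => 6 * Nat.pair s.enc t.enc + 1
  | .and A B => 6 * Nat.pair A.enc B.enc + 2
  | .or A B => 6 * Nat.pair A.enc B.enc + 3
  | .all A => 6 * A.enc + 4
  | .ex A => 6 * A.enc + 5

/-- Fuelled decoding of formulas. -/
def Fml.dec : ℕ → ℕ → Option Fml
  | 0, _ => none
  | fuel + 1, n =>
    if n % 6 = 0 then
      match Encodable.decode (α := Trm) (n / 6).unpair.1,
            Encodable.decode (α := Trm) (n / 6).unpair.2 with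
      | some s, some t => some (.eq s t)
      | _, _ => none
    else if n % 6 = 1 then
      match Encodable.decode (α := Trm) (n / 6).unpair.1,
            Encodable.decode (α := Trm) (n / 6).unpair.2 with
      | some s, some t => some (.ne s t)
      | _, _ => none
    else if n % 6 = 2 then
      match Fml.dec fuel (n / 6).unpair.1, Fml.dec fuel (n / 6).unpair.2 with
      | some A, some B => some (.and A B)
      | _, _ => none
    else if n % 6 = 3 then
      match Fml.dec fuel (n / 6).unpair.1, Fml.dec fuel (n / 6).unpair.2 with
      | some A, some B => some (.or A B)
      | _, _ => none
    else if n % 6 = 4 then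
      match Fml.dec fuel (n / 6) with
      | some A => some (.all A)
      | none => none
    else
      match Fml.dec fuel (n / 6) with
      | some A => some (.ex A)
      | none => none

theorem Fml.dec_enc : ∀ (A : Fml) (fuel : ℕ), A.enc < fuel → Fml.dec fuel A.enc = some A := by
  intro A
  induction A with
  | eq s u =>
    intro fuel h
    match fuel with
    | f + 1 =>
      simp only [Fml.enc] at h ⊢
      set p := Nat.pair s.enc u.enc with hp
      have h0 : (6 * p) % 6 = 0 := by omega
      have h1 : (6 * p) / 6 = p := by omega
      have hds : Encodable.decode (α := Trm) s.enc = some s := Encodable.encodek s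
      have hdu : Encodable.decode (α := Trm) u.enc = some u := Encodable.encodek u
      simp only [Fml.dec, h0, h1]
      rw [hp, Nat.unpair_pair, hds, hdu]
      simp
  | ne s u =>
    intro fuel h
    match fuel with
    | f + 1 =>
      simp only [Fml.enc] at h ⊢
      set p := Nat.pair s.enc u.enc with hp
      have h0 : (6 * p + 1) % 6 = 1 := by omega
      have h1 : (6 * p + 1) / 6 = p := by omega
      have hds : Encodable.decode (α := Trm) s.enc = some s := Encodable.encodek s
      have hdu : Encodable.decode (α := Trm) u.enc = some u := Encodable.encodek u
      simp only [Fml.dec, h0, h1]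
      rw [hp, Nat.unpair_pair, hds, hdu]
      simp
  | and A B ihA ihB =>
    intro fuel h
    match fuel with
    | f + 1 =>
      simp only [Fml.enc] at h ⊢
      set p := Nat.pair A.enc B.enc with hp
      have h0 : (6 * p + 2) % 6 = 2 := by omega
      have h1 : (6 * p + 2) / 6 = p := by omega
      have hA : A.enc < f := by
        have := Nat.left_le_pair A.enc B.enc
        omega
      have hB : B.enc < f := by
        have := Nat.right_le_pair A.enc B.enc
        omega
      simp only [Fml.dec, h0, h1]
      rw [hp, Nat.unpair_pair, ihA f hA, ihB f hB]
      simp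
  | or A B ihA ihB =>
    intro fuel h
    match fuel with
    | f + 1 =>
      simp only [Fml.enc] at h ⊢
      set p := Nat.pair A.enc B.enc with hp
      have h0 : (6 * p + 3) % 6 = 3 := by omega
      have h1 : (6 * p + 3) / 6 = p := by omega
      have hA : A.enc < f := by
        have := Nat.left_le_pair A.enc B.enc
        omega
      have hB : B.enc < f := by
        have := Nat.right_le_pair A.enc B.enc
        omega
      simp only [Fml.dec, h0, h1]
      rw [hp, Nat.unpair_pair, ihA f hA, ihB f hB]
      simp
  | all A ihA =>
    intro fuel h
    match fuel with
    | f + 1 =>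
      simp only [Fml.enc] at h ⊢
      have h0 : (6 * A.enc + 4) % 6 = 4 := by omega
      have h1 : (6 * A.enc + 4) / 6 = A.enc := by omega
      have hA : A.enc < f := by omega
      simp [Fml.dec, h0, h1, ihA f hA]
  | ex A ihA =>
    intro fuel h
    match fuel with
    | f + 1 =>
      simp only [Fml.enc] at h ⊢
      have h0 : (6 * A.enc + 5) % 6 = 5 := by omega
      have h1 : (6 * A.enc + 5) / 6 = A.enc := by omega
      have hA : A.enc < f := by omega
      simp [Fml.dec, h0, h1, ihA f hA]

instance : Encodable Fml :=
  ⟨Fml.enc, fun n => Fml.dec (n + 1) n, fun A => Fml.dec_enc A _ (Nat.lt_succ_self _)⟩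

/-- Gödel number of a sentence. -/
def encF (A : Sentence) : ℕ := Encodable.encode A

/-- Gödel number of a sequent (finite set of sentences). -/
def encS (Γ : Finset Sentence) : ℕ := Encodable.encode Γ

/-- Decode a Gödel number into a sentence (with a default value). -/
def decF (n : ℕ) : Sentence := (Encodable.decode (α := Sentence) n).getD ⟨.eq .zero .zero, rfl⟩

/-- Decode a Gödel number into a sequent (with a default value). -/
def decS (n : ℕ) : Finset Sentence := (Encodable.decode (α := Finset Sentence) n).getD ∅

/-! ### Tupling of natural numbers, with projections -/

/-- Code of a finite sequence (tuple) of natural numbers; codes are nonzero. -/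
def tup (l : List ℕ) : ℕ := Encodable.encode l + 1

/-- The finite sequence coded by a natural number. -/
def untup (a : ℕ) : List ℕ := Denumerable.ofNat (List ℕ) (a - 1)

/-- The `i`-th projection `(a)_i`. -/
def proj (a i : ℕ) : ℕ := (untup a).getD i 0

/-- `a` codes a finite sequence (every nonzero number does, bijectively). -/
def InSeq (a : ℕ) : Prop := a ≠ 0

/-- The code of the empty sequence `⟨⟩` (the root). -/
def rootSeq : ℕ := tup []

/-- The code of `σ⌢i`. -/
def snoc (σ i : ℕ) : ℕ := tup (untup σ ++ [i])

/-! ### Names for the inference rules -/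

def axC : ℕ := 1
def andC : ℕ := 2
def orC : ℕ := 3
def omC : ℕ := 4
def exC : ℕ := 5
def cutC : ℕ := 6
def omrepC : ℕ := 7

/-- The end sequent of a (code of a) proof or proof node: `(a)_1` if the rule
`(a)_0` carries no main formula, and `(a)_1 ∪ {(a)_2}` otherwise. -/
def EndS (a : ℕ) : Finset Sentence :=
  if proj a 0 = cutC ∨ proj a 0 = axC ∨ proj a 0 = omrepC then decS (proj a 1)
  else decS (proj a 1) ∪ {decF (proj a 2)}

/-! ### Local codes of ω-proofs -/

/-- Local codes of `ω`-proofs, in Tait style.  The three `Bool` parameters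
respectively allow the cut rule, restrict the `ω`-rule to indices of primitive
recursive functions, and allow the vacuous `ω`-repetition rule. -/
inductive CGen (c p r : Bool) : ℕ → Prop
  | ax (Γ : Finset Sentence) (h : IsAxiom Γ) : CGen c p r (tup [axC, encS Γ])
  | and {a b : ℕ} (Γ : Finset Sentence) (A B : Sentence)
      (ha : CGen c p r a) (hb : CGen c p r b)
      (ea : EndS a = Γ ∪ {A}) (eb : EndS b = Γ ∪ {B}) :
      CGen c p r (tup [andC, encS Γ, encF (sAnd A B), a, b])
  | or {a : ℕ} (Γ : Finset Sentence) (A B : Sentence) (ha : CGen c p r a)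
      (ea : EndS a = Γ ∪ {A, B}) :
      CGen c p r (tup [orC, encS Γ, encF (sOr A B), a])
  | om {e : ℕ} (Γ : Finset Sentence) (A : Fml) (hA : A.cu 1 = true)
      (hp : p = true → PrimIndex e)
      (htot : ∀ n, (peval e n).Dom)
      (hmem : ∀ n, CGen c p r ((peval e n).get (htot n)))
      (hend : ∀ n, EndS ((peval e n).get (htot n)) = Γ ∪ {sInst A hA n}) :
      CGen c p r (tup [omC, encS Γ, encF (sAll A hA), e])
  | ex {a : ℕ} (Γ : Finset Sentence) (A : Fml) (hA : A.cu 1 = true) (n : ℕ)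
      (ha : CGen c p r a) (ea : EndS a = Γ ∪ {sInst A hA n}) :
      CGen c p r (tup [exC, encS Γ, encF (sEx A hA), a])
  | cut {a b : ℕ} (hc : c = true) (Γ : Finset Sentence) (C : Sentence)
      (ha : CGen c p r a) (hb : CGen c p r b)
      (ea : EndS a = Γ ∪ {C}) (eb : EndS b = Γ ∪ {sNeg C}) :
      CGen c p r (tup [cutC, encS Γ, encF C, a, b])
  | omrep {e : ℕ} (hr : r = true) (Γ : Finset Sentence) (hp : PrimIndex e)
      (htot : ∀ n, (peval e n).Dom)
      (hmem : ∀ n, CGen c p r ((peval e n).get (htot n)))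
      (hend : ∀ n, EndS ((peval e n).get (htot n)) = Γ) :
      CGen c p r (tup [omrepC, encS Γ, e])

/-- `C_rec`: recursive local codes of `ω`-proofs. -/
def Crec : ℕ → Prop := CGen true false false

/-- `C_rec^-`: the cut free fragment of `C_rec`. -/
def CrecM : ℕ → Prop := CGen false false false

/-- `C_prec`: primitive recursive local codes of `ω`-proofs. -/
def Cprec : ℕ → Prop := CGen true true false

/-- `C_prec^-`: the cut free fragment of `C_prec`. -/
def CprecM : ℕ → Prop := CGen false true false

/-- `C_prec^{ω-rep}`: `C_prec` with the vacuous `ω`-repetition rule. -/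
def CprecRep : ℕ → Prop := CGen true true true

/-! ### ω-proofs as well founded trees of sequents -/

/-- `σ` is a node of the tree `T_π = {σ ∈ Seq : π(σ) ∈ Seq}`. -/
def TreeOf (π : ℕ → ℕ) (σ : ℕ) : Prop := σ ≠ 0 ∧ π σ ≠ 0

/-- The tree `T_π` is well founded: it has no infinite branch. -/
def WFTree (π : ℕ → ℕ) : Prop :=
  ¬ ∃ f : ℕ → ℕ, ∀ n : ℕ, TreeOf π (tup ((List.range n).map f))

/-- The inference at an inner node of an `ω`-proof is a correct instance of one
of the rules of Tait-style `ω`-arithmetic. -/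
def CorrectInner (π : ℕ → ℕ) (σ : ℕ) : Prop :=
  (∃ (Γ : Finset Sentence) (A B : Sentence),
    π σ = tup [andC, encS Γ, encF (sAnd A B)] ∧
    TreeOf π (snoc σ 0) ∧ TreeOf π (snoc σ 1) ∧ ¬ TreeOf π (snoc σ 2) ∧
    EndS (π (snoc σ 0)) = Γ ∪ {A} ∧ EndS (π (snoc σ 1)) = Γ ∪ {B}) ∨
  (∃ (Γ : Finset Sentence) (A B : Sentence),
    π σ = tup [orC, encS Γ, encF (sOr A B)] ∧
    TreeOf π (snoc σ 0) ∧ ¬ TreeOf π (snoc σ 1) ∧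
    EndS (π (snoc σ 0)) = Γ ∪ {A, B}) ∨
  (∃ (Γ : Finset Sentence) (A : Fml) (hA : A.cu 1 = true),
    π σ = tup [omC, encS Γ, encF (sAll A hA)] ∧
    (∀ n : ℕ, TreeOf π (snoc σ n)) ∧
    (∀ n : ℕ, EndS (π (snoc σ n)) = Γ ∪ {sInst A hA n})) ∨
  (∃ (Γ : Finset Sentence) (A : Fml) (hA : A.cu 1 = true) (n : ℕ),
    π σ = tup [exC, encS Γ, encF (sEx A hA)] ∧
    TreeOf π (snoc σ 0) ∧ ¬ TreeOf π (snoc σ 1) ∧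
    EndS (π (snoc σ 0)) = Γ ∪ {sInst A hA n}) ∨
  (∃ (Γ : Finset Sentence) (C : Sentence),
    π σ = tup [cutC, encS Γ, encF C] ∧
    TreeOf π (snoc σ 0) ∧ TreeOf π (snoc σ 1) ∧ ¬ TreeOf π (snoc σ 2) ∧
    EndS (π (snoc σ 0)) = Γ ∪ {C} ∧ EndS (π (snoc σ 1)) = Γ ∪ {sNeg C})

/-- Local correctness of a function `π : ℕ → ℕ` viewed as a tree of sequents:
all conditions in the definition of `ω`-proof except well-foundedness. -/
structure LocallyCorrect (π : ℕ → ℕ) : Prop where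
  /-- values outside `Seq` are `0` -/
  nonseq : ∀ σ, ¬ InSeq (π σ) → π σ = 0
  /-- `T_π` is closed under initial segments -/
  downward : ∀ σ τ, TreeOf π σ → τ ≠ 0 → untup τ <+: untup σ → TreeOf π τ
  /-- children come first -/
  mono : ∀ σ i j, i < j → TreeOf π (snoc σ j) → TreeOf π (snoc σ i)
  /-- top nodes are axioms -/
  top : ∀ σ, TreeOf π σ → ¬ TreeOf π (snoc σ 0) →
    ∃ Γ : Finset Sentence, IsAxiom Γ ∧ π σ = tup [axC, encS Γ]
  /-- inner nodes are correct inferences -/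
  inner : ∀ σ, TreeOf π σ → TreeOf π (snoc σ 0) → CorrectInner π σ

/-- `π : ℕ → ℕ` is an `ω`-proof. -/
structure IsOmegaProof (π : ℕ → ℕ) extends LocallyCorrect π : Prop where
  /-- the tree `T_π` is well founded -/
  wf : WFTree π

/-- An `ω`-proof is cut free if no node is labelled `cut`. -/
def CutFree (π : ℕ → ℕ) : Prop := ∀ σ, TreeOf π σ → proj (π σ) 0 ≠ cutC

/-! ### The ω-proof `π(a)` coded by a local code `a` -/

open Classical in
/-- The code of the subproof at child `n` of the proof coded by `a`. -/
noncomputable def childCode (a n : ℕ) : ℕ :=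
  if proj a 0 = omC then
    (if h : (peval (proj a 3) n).Dom then (peval (proj a 3) n).get h else 0)
  else if proj a 0 = andC ∨ proj a 0 = orC ∨ proj a 0 = exC ∨ proj a 0 = cutC then
    proj a (n + 3)
  else 0

/-- Walk down a local code along a path. -/
noncomputable def walkCode (a : ℕ) : List ℕ → ℕ
  | [] => a
  | i :: l => walkCode (childCode a i) l

/-- The node label `⟨R,Γ,A⟩` (or `⟨Ax,Γ⟩`) determined by a local code. -/
def nodeVal (b : ℕ) : ℕ :=
  if proj b 0 = axC then tup [axC, proj b 1]
  else if proj b 0 = andC ∨ proj b 0 = orC ∨ proj b 0 = omC ∨ proj b 0 = exC ∨ proj b 0 = cutC then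
    tup [proj b 0, proj b 1, proj b 2]
  else 0

/-- The `ω`-proof `π(a)` determined by a local code `a` (with value `0` at all
other arguments). -/
noncomputable def piOf (a : ℕ) (σ : ℕ) : ℕ :=
  if σ = 0 then 0 else nodeVal (walkCode a (untup σ))

/-! ### Indices (global codes) of recursive and primitive recursive ω-proofs -/

/-- `I_rec`: `a` is an index of a recursive `ω`-proof. -/
def Irec (a : ℕ) : Prop :=
  ∃ h : ∀ n, (peval a n).Dom, IsOmegaProof (fun n => (peval a n).get (h n))

/-- `I_prec`: `a` is an index of a primitive recursive `ω`-proof. -/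
def Iprec (a : ℕ) : Prop :=
  ∃ f : ℕ → ℕ, Nat.Primrec f ∧ (∀ n, peval a n = Part.some (f n)) ∧ IsOmegaProof f

/-- `I_prec^-`: `a` is an index of a primitive recursive cut free `ω`-proof. -/
def IprecM (a : ℕ) : Prop :=
  ∃ f : ℕ → ℕ, Nat.Primrec f ∧ (∀ n, peval a n = Part.some (f n)) ∧
    IsOmegaProof f ∧ CutFree f

/-! ### Ordinal lengths -/

open Classical in
/-- `x + 1` if `P` holds, and `0` otherwise. -/
noncomputable def succIf (P : Prop) (x : Ordinal.{0}) : Ordinal.{0} :=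
  if P then x + 1 else 0

/-- The ordinal rank of a node of the tree `T_π`:
`rank σ = sup {rank (σ⌢i) + 1 : σ⌢i ∈ T_π}`. -/
inductive NodeRank (π : ℕ → ℕ) : ℕ → Ordinal.{0} → Prop
  | mk (σ : ℕ) (o : ℕ → Ordinal.{0})
      (h : ∀ i, TreeOf π (snoc σ i) → NodeRank π (snoc σ i) (o i)) :
      NodeRank π σ (⨆ i, succIf (TreeOf π (snoc σ i)) (o i))

/-- The ordinal length of a local code:  `|⟨Ax,Γ⟩| = 0`,
`|⟨R,Γ,A,a₁,…,a_k⟩| = sup{|a₁|,…,|a_k|} + 1`, and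
`|⟨ω,Γ,∀xA(x),e⟩| = sup{|⟨e⟩(n)| + 1 : n ∈ ℕ}`. -/
inductive CLen : ℕ → Ordinal.{0} → Prop
  | ax (g : ℕ) : CLen (tup [axC, g]) 0
  | one (R g x a : ℕ) (o : Ordinal.{0}) (hR : R = orC ∨ R = exC) (h : CLen a o) :
      CLen (tup [R, g, x, a]) (o + 1)
  | two (R g x a b : ℕ) (oa ob : Ordinal.{0}) (hR : R = andC ∨ R = cutC)
      (ha : CLen a oa) (hb : CLen b ob) :
      CLen (tup [R, g, x, a, b]) ((oa ⊔ ob) + 1)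
  | om (g x e : ℕ) (h : ∀ n, (peval e n).Dom) (o : ℕ → Ordinal.{0})
      (ho : ∀ n, CLen ((peval e n).get (h n)) (o n)) :
      CLen (tup [omC, g, x, e]) (⨆ n, o n + 1)

/-- The ordinal `|a|` of a notation `a ∈ O`:  `|1| = 0`, `|2^a| = |a| + 1`,
`|3·5^e| = sup{|⟨e⟩(n)| : n ∈ ℕ}`. -/
inductive KOrd : ℕ → Ordinal.{0} → Prop
  | one : KOrd 1 0
  | step {a : ℕ} {o : Ordinal.{0}} : KOrd a o → KOrd (2 ^ a) (o + 1)
  | lim {e : ℕ} (h : ∀ n, (peval e n).Dom) (o : ℕ → Ordinal.{0})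
      (ho : ∀ n, KOrd ((peval e n).get (h n)) (o n)) :
      KOrd (3 * 5 ^ e) (⨆ n, o n)


open Classical in
/-- One step of the sequence `a(f)` determined by a local code. -/
noncomputable def branchStep (b k : ℕ) : Option ℕ :=
  if (∃ (Γ : Finset Sentence) (A B : Sentence) (b₀ b₁ : ℕ),
        b = tup [andC, encS Γ, encF (sAnd A B), b₀, b₁]) ∨
     (∃ (Γ : Finset Sentence) (C : Sentence) (b₀ b₁ : ℕ),
        b = tup [cutC, encS Γ, encF C, b₀, b₁]) then
    some (proj b (3 + k % 2))
  else if ∃ (Γ : Finset Sentence) (A B : Sentence) (c : ℕ),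
      b = tup [orC, encS Γ, encF (sOr A B), c] then
    some (proj b 3)
  else if ∃ (Γ : Finset Sentence) (A : Fml) (hA : A.cu 1 = true) (e : ℕ),
      b = tup [omC, encS Γ, encF (sAll A hA), e] then
    (if h : (peval (proj b 3) k).Dom then some ((peval (proj b 3) k).get h) else none)
  else none

/-- The sequence `a(f) = ⟨a₀,a₁,…⟩`:  `chain a f i = some aᵢ` if the `i`-th
element of the sequence is defined, and `none` otherwise. -/
noncomputable def chain (a : ℕ) (f : ℕ → ℕ) : ℕ → Option ℕ
  | 0 => some a
  | i + 1 =>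
    match chain a f i with
    | none => none
    | some b => branchStep b (f i)

/-! ### Primitive recursive operations on codes of sequents -/

/-- `Multiset.pairwise_sort` with its instance arguments found by unification. -/
theorem pairwise_sort_of_unify {α : Type*} {s : Multiset α} {r : α → α → Prop}
    {_ : DecidableRel r} {_ : IsTrans α r} {_ : Std.Antisymm r} {_ : Std.Total r} :
    (s.sort r).Pairwise r := Multiset.pairwise_sort s r

theorem encS_eq_encode_sorted (Γ : Finset Sentence) :
    ∃ l : List Sentence, encS Γ = Encodable.encode l ∧
      l.Pairwise (fun A B => encF A ≤ encF B) ∧ l.Nodup ∧ ∀ A, A ∈ l ↔ A ∈ Γ := by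
  refine ⟨_, rfl, ?_, ?_, ?_⟩
  · exact pairwise_sort_of_unify
  · refine (Multiset.coe_nodup).1 ?_
    rw [Multiset.sort_eq]
    exact Γ.nodup
  · intro A
    rw [← Multiset.mem_coe, Multiset.sort_eq]
    rfl

theorem encF_injective : Function.Injective encF := Encodable.encode_injective

theorem encode_list_map_encF : ∀ l : List Sentence,
    Encodable.encode (l.map encF) = Encodable.encode l
  | [] => rfl
  | A :: l => by
    simp only [List.map_cons, Encodable.encode_list_cons, encode_list_map_encF l, encF,
      Encodable.encode_nat]

/-- The list of the codes of the members of a coded sequent. -/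
def seqList (s : ℕ) : List ℕ := Denumerable.ofNat (List ℕ) s

theorem encode_seqList (s : ℕ) : Encodable.encode (seqList s) = s := Denumerable.encode_ofNat s

theorem seqList_encS (Γ : Finset Sentence) :
    (seqList (encS Γ)).Pairwise (· < ·) ∧ ∀ x, x ∈ seqList (encS Γ) ↔ ∃ A ∈ Γ, encF A = x := by
  obtain ⟨l, hl, hsort, hnodup, hmem⟩ := encS_eq_encode_sorted Γ
  have h : seqList (encS Γ) = l.map encF := by
    rw [hl, ← encode_list_map_encF, seqList, Denumerable.ofNat_encode]
  rw [h]
  refine ⟨?_, by simp [hmem]⟩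
  rw [List.pairwise_map]
  refine hsort.imp₂ ?_ hnodup
  intro A B hle hne
  exact lt_of_le_of_ne hle fun he => hne (encF_injective he)

/-- Insertion into a strictly increasing list of natural numbers. -/
def insertSorted (x : ℕ) (l : List ℕ) : List ℕ :=
  l.recOn [x] fun y l ih => if x < y then x :: y :: l else if x = y then y :: l else y :: ih

theorem insertSorted_cons (x y : ℕ) (l : List ℕ) : insertSorted x (y :: l) =
    if x < y then x :: y :: l else if x = y then y :: l else y :: insertSorted x l := rfl

theorem mem_insertSorted (x z : ℕ) : ∀ l : List ℕ, z ∈ insertSorted x l ↔ z = x ∨ z ∈ l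
  | [] => by simp [insertSorted]
  | y :: l => by
    have ih := mem_insertSorted x z l
    rw [insertSorted_cons]
    grind

theorem insertSorted_pairwise (x : ℕ) : ∀ l : List ℕ, l.Pairwise (· < ·) →
    (insertSorted x l).Pairwise (· < ·)
  | [], _ => by simp [insertSorted]
  | y :: l, h => by
    have ih := insertSorted_pairwise x l (List.pairwise_cons.1 h).2
    have hmem := fun z => mem_insertSorted x z l
    rw [insertSorted_cons]
    simp only [List.pairwise_cons] at h
    split_ifs <;> simp only [List.pairwise_cons] <;> grind

/-- Insertion of a coded sentence into a coded sequent. -/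
def insertCode (x s : ℕ) : ℕ := Encodable.encode (insertSorted x (seqList s))

theorem insertCode_encS (A : Sentence) (Γ : Finset Sentence) :
    insertCode (encF A) (encS Γ) = encS (insert A Γ) := by
  obtain ⟨hs, hm⟩ := seqList_encS Γ
  obtain ⟨hs', hm'⟩ := seqList_encS (insert A Γ)
  rw [insertCode, ← encode_seqList (encS (insert A Γ))]
  congr 1
  refine (insertSorted_pairwise _ _ hs).eq_of_mem_iff hs' fun x => ?_
  rw [mem_insertSorted, hm, hm', Finset.exists_mem_insert, eq_comm]

theorem insertSorted_primrec : Primrec₂ insertSorted := by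
  refine Primrec.to₂ <| Primrec.list_rec
    (h := fun (p : ℕ × List ℕ) (q : ℕ × List ℕ × List ℕ) => if p.1 < q.1 then p.1 :: q.1 :: q.2.1
      else if p.1 = q.1 then q.1 :: q.2.1 else q.1 :: q.2.2) Primrec.snd
    (Primrec.list_cons.comp Primrec.fst (Primrec.const [])) ?_
  have hx : Primrec fun r : (ℕ × List ℕ) × (ℕ × List ℕ × List ℕ) => r.1.1 :=
    Primrec.fst.comp Primrec.fst
  have hy : Primrec fun r : (ℕ × List ℕ) × (ℕ × List ℕ × List ℕ) => r.2.1 :=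
    Primrec.fst.comp Primrec.snd
  have hl : Primrec fun r : (ℕ × List ℕ) × (ℕ × List ℕ × List ℕ) => r.2.2.1 :=
    Primrec.fst.comp (Primrec.snd.comp Primrec.snd)
  have hi : Primrec fun r : (ℕ × List ℕ) × (ℕ × List ℕ × List ℕ) => r.2.2.2 :=
    Primrec.snd.comp (Primrec.snd.comp Primrec.snd)
  exact (Primrec.ite (Primrec.nat_lt.comp hx hy)
    (Primrec.list_cons.comp hx (Primrec.list_cons.comp hy hl))
    (Primrec.ite (Primrec.eq.comp hx hy) (Primrec.list_cons.comp hy hl)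
      (Primrec.list_cons.comp hy hi))).to₂

theorem insertCode_primrec : Primrec₂ insertCode :=
  (Primrec.encode.comp (insertSorted_primrec.comp Primrec.fst
    ((Primrec.ofNat (List ℕ)).comp Primrec.snd))).to₂

theorem decS_encS (Γ : Finset Sentence) : decS (encS Γ) = Γ := by
  simp [decS, encS]

theorem decF_encF (A : Sentence) : decF (encF A) = A := by
  simp [decF, encF]

/-! ### Primitive recursive tupling -/

theorem proj_tup (l : List ℕ) (i : ℕ) : proj (tup l) i = l.getD i 0 := by
  simp [proj, tup, untup]

theorem proj_primrec : Primrec₂ proj :=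
  ((Primrec.list_getD 0).comp ((Primrec.ofNat (List ℕ)).comp
    (Primrec.nat_sub.comp Primrec.fst (Primrec.const 1))) Primrec.snd).to₂

theorem tup_primrec : Primrec tup := Primrec.succ.comp Primrec.encode

/-- The code of the end sequent of a coded proof. -/
def endCode (a : ℕ) : ℕ :=
  if proj a 0 = cutC ∨ proj a 0 = axC ∨ proj a 0 = omrepC then proj a 1
  else insertCode (proj a 2) (proj a 1)

theorem endCode_primrec : Primrec endCode := by
  have hp (i : ℕ) : Primrec fun a => proj a i := proj_primrec.comp Primrec.id (Primrec.const i)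
  have he (i : ℕ) : PrimrecPred fun a => proj a 0 = i := Primrec.eq.comp (hp 0) (Primrec.const i)
  exact Primrec.ite ((he _).or ((he _).or (he _))) (hp 1) (insertCode_primrec.comp (hp 2) (hp 1))

theorem endCode_eq {c p r : Bool} {a : ℕ} (h : CGen c p r a) : endCode a = encS (EndS a) := by
  cases h <;>
    simp [endCode, EndS, proj_tup, decS_encS, decF_encF, insertCode_encS, axC, andC, orC, omC, exC,
      cutC, omrepC, Finset.union_comm _ {_}]

/-! ### Primitive recursive substitution of numerals -/

theorem numeral_enc_primrec : Primrec fun n => (numeral n).enc :=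
  (Primrec.nat_rec₁ (f := fun _ x => 5 * Nat.pair x 2 + 3) 1
    (Primrec.nat_add.comp (Primrec.nat_mul.comp (Primrec.const 5)
      (Primrec₂.natPair.comp Primrec.snd (Primrec.const 2))) (Primrec.const 3)).to₂).of_eq fun n => by
    induction n with
    | zero => rfl
    | succ n ih => simp only [numeral, Trm.enc, ih]

/-- Substitution in coded terms: `p.1` is the code of the substituted term and `p.2` the variable. -/
def subTrmCode (p : ℕ × ℕ) (s : ℕ) : ℕ :=
  if s % 5 = 0 then if s / 5 = p.2 then p.1 else if p.2 < s / 5 then 5 * (s / 5 - 1) else s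
  else if s % 5 ≤ 2 then s
  else 5 * Nat.pair (subTrmCode p (s / 5).unpair.1) (subTrmCode p (s / 5).unpair.2) + s % 5
termination_by s
decreasing_by
  · have := Nat.unpair_left_le (s / 5); omega
  · have := Nat.unpair_right_le (s / 5); omega

theorem subTrmCode_enc (t : Trm) (k : ℕ) (s : Trm) :
    subTrmCode (t.enc, k) s.enc = (Trm.sub t k s).enc := by
  induction s with
  | var i =>
    rw [subTrmCode]
    have h : 5 * i / 5 = i := by omega
    simp only [Trm.enc, Trm.sub, h]
    split_ifs <;> first | omega | simp [Trm.enc]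
  | zero => rw [subTrmCode]; simp [Trm.enc, Trm.sub]
  | one => rw [subTrmCode]; simp [Trm.enc, Trm.sub]
  | add s u ihs ihu =>
    rw [subTrmCode]
    have h (p : ℕ) : (5 * p + 3) / 5 = p := by omega
    have h' (p : ℕ) : (5 * p + 3) % 5 = 3 := by omega
    simp [Trm.enc, Trm.sub, h, h', ihs, ihu]
  | mul s u ihs ihu =>
    rw [subTrmCode]
    have h (p : ℕ) : (5 * p + 4) / 5 = p := by omega
    have h' (p : ℕ) : (5 * p + 4) % 5 = 4 := by omega
    simp [Trm.enc, Trm.sub, h, h', ihs, ihu]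

theorem subTrmCode_primrec : Primrec₂ subTrmCode := by
  refine Primrec.nat_strong_rec subTrmCode (g := fun p l => some
    (if l.length % 5 = 0 then if l.length / 5 = p.2 then p.1
        else if p.2 < l.length / 5 then 5 * (l.length / 5 - 1) else l.length
      else if l.length % 5 ≤ 2 then l.length
      else 5 * Nat.pair (l.getD (l.length / 5).unpair.1 0) (l.getD (l.length / 5).unpair.2 0)
        + l.length % 5)) ?_ ?_
  · have ht : Primrec fun q : (ℕ × ℕ) × List ℕ => q.1.1 := Primrec.fst.comp Primrec.fst
    have hk : Primrec fun q : (ℕ × ℕ) × List ℕ => q.1.2 := Primrec.snd.comp Primrec.fst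
    have hs : Primrec fun q : (ℕ × ℕ) × List ℕ => q.2.length :=
      Primrec.list_length.comp Primrec.snd
    have hd : Primrec fun q : (ℕ × ℕ) × List ℕ => q.2.length / 5 :=
      Primrec.nat_div.comp hs (Primrec.const 5)
    have hm : Primrec fun q : (ℕ × ℕ) × List ℕ => q.2.length % 5 :=
      Primrec.nat_mod.comp hs (Primrec.const 5)
    refine (Primrec.option_some.comp (Primrec.ite (Primrec.eq.comp hm (Primrec.const 0))
      (Primrec.ite (Primrec.eq.comp hd hk) ht (Primrec.ite (Primrec.nat_lt.comp hk hd)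
        (Primrec.nat_mul.comp (Primrec.const 5) (Primrec.nat_sub.comp hd (Primrec.const 1))) hs))
      (Primrec.ite (Primrec.nat_le.comp hm (Primrec.const 2)) hs
        (Primrec.nat_add.comp (Primrec.nat_mul.comp (Primrec.const 5) (Primrec₂.natPair.comp
          ((Primrec.list_getD 0).comp Primrec.snd (Primrec.fst.comp (Primrec.unpair.comp hd)))
          ((Primrec.list_getD 0).comp Primrec.snd (Primrec.snd.comp (Primrec.unpair.comp hd)))))
          hm)))).to₂
  · intro p s
    rw [subTrmCode]
    have h₁ := Nat.unpair_left_le (s / 5)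
    have h₂ := Nat.unpair_right_le (s / 5)
    simp only [List.length_map, List.length_range]
    split_ifs with h _ _ h' <;> try rfl
    simp [List.getD, show (s / 5).unpair.1 < s by omega, show (s / 5).unpair.2 < s by omega]

/-- Simultaneous substitution of the term with code `p.1` for each variable below `p.2` in a coded
formula; entry `k` of the result belongs to variable `k`. -/
def subFmlCode (p : ℕ × ℕ) (m : ℕ) : List ℕ :=
  (List.range p.2).map fun k =>
    if m % 6 ≤ 1 then
      6 * Nat.pair (subTrmCode (p.1, k) (m / 6).unpair.1) (subTrmCode (p.1, k) (m / 6).unpair.2)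
        + m % 6
    else if m % 6 ≤ 3 then
      6 * Nat.pair ((subFmlCode p (m / 6).unpair.1).getD k 0)
        ((subFmlCode p (m / 6).unpair.2).getD k 0) + m % 6
    else 6 * (subFmlCode p (m / 6)).getD (k + 1) 0 + m % 6
termination_by m
decreasing_by
  · have := Nat.unpair_left_le (m / 6); omega
  · have := Nat.unpair_right_le (m / 6); omega
  · omega

theorem subFmlCode_enc (t : Trm) (b : ℕ) (A : Fml) : ∀ k, k + A.enc < b →
    (subFmlCode (t.enc, b) A.enc).getD k 0 = (A.sub t k).enc := by
  have h (p r : ℕ) (hr : r < 6) : (6 * p + r) / 6 = p := by omega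
  have h' (p r : ℕ) (hr : r < 6) : (6 * p + r) % 6 = r := by omega
  have h0 (p : ℕ) : 6 * p / 6 = p := by omega
  induction A with
  | eq s u =>
    intro k hk
    rw [subFmlCode]
    simp [List.getD, show k < b by omega, Fml.enc, Fml.sub, h0, subTrmCode_enc]
  | ne s u =>
    intro k hk
    rw [subFmlCode]
    simp [List.getD, show k < b by omega, Fml.enc, Fml.sub, h, h', subTrmCode_enc]
  | and A B ihA ihB =>
    intro k hk
    have hA := Nat.left_le_pair A.enc B.enc
    have hB := Nat.right_le_pair A.enc B.enc
    simp only [Fml.enc] at hk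
    have ihA := ihA k (by omega)
    have ihB := ihB k (by omega)
    simp only [List.getD] at ihA ihB
    rw [subFmlCode]
    simp [List.getD, show k < b by omega, Fml.enc, Fml.sub, h, h', ihA, ihB]
  | or A B ihA ihB =>
    intro k hk
    have hA := Nat.left_le_pair A.enc B.enc
    have hB := Nat.right_le_pair A.enc B.enc
    simp only [Fml.enc] at hk
    have ihA := ihA k (by omega)
    have ihB := ihB k (by omega)
    simp only [List.getD] at ihA ihB
    rw [subFmlCode]
    simp [List.getD, show k < b by omega, Fml.enc, Fml.sub, h, h', ihA, ihB]
  | all A ihA =>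
    intro k hk
    simp only [Fml.enc] at hk
    have ihA := ihA (k + 1) (by omega)
    simp only [List.getD] at ihA
    rw [subFmlCode]
    simp [List.getD, show k < b by omega, Fml.enc, Fml.sub, h, h', ihA]
  | ex A ihA =>
    intro k hk
    simp only [Fml.enc] at hk
    have ihA := ihA (k + 1) (by omega)
    simp only [List.getD] at ihA
    rw [subFmlCode]
    simp [List.getD, show k < b by omega, Fml.enc, Fml.sub, h, h', ihA]

theorem subFmlCode_primrec : Primrec₂ subFmlCode := by
  refine Primrec.nat_strong_rec subFmlCode (g := fun p l => some
    ((List.range p.2).map fun k =>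
      if l.length % 6 ≤ 1 then
        6 * Nat.pair (subTrmCode (p.1, k) (l.length / 6).unpair.1)
          (subTrmCode (p.1, k) (l.length / 6).unpair.2) + l.length % 6
      else if l.length % 6 ≤ 3 then
        6 * Nat.pair ((l.getD (l.length / 6).unpair.1 []).getD k 0)
          ((l.getD (l.length / 6).unpair.2 []).getD k 0) + l.length % 6
      else 6 * (l.getD (l.length / 6) []).getD (k + 1) 0 + l.length % 6)) ?_ ?_
  · refine Primrec₂.option_some_iff.2 ?_
    refine Primrec.list_map (Primrec.list_range.comp (Primrec.snd.comp Primrec.fst)) ?_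
    have ht : Primrec fun q : ((ℕ × ℕ) × List (List ℕ)) × ℕ => q.1.1.1 :=
      Primrec.fst.comp (Primrec.fst.comp Primrec.fst)
    have hl : Primrec fun q : ((ℕ × ℕ) × List (List ℕ)) × ℕ => q.1.2 :=
      Primrec.snd.comp Primrec.fst
    have hk : Primrec fun q : ((ℕ × ℕ) × List (List ℕ)) × ℕ => q.2 := Primrec.snd
    have hn := Primrec.list_length.comp hl
    have hd := Primrec.nat_div.comp hn (Primrec.const 6)
    have hm := Primrec.nat_mod.comp hn (Primrec.const 6)
    have hd₁ := Primrec.fst.comp (Primrec.unpair.comp hd)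
    have hd₂ := Primrec.snd.comp (Primrec.unpair.comp hd)
    have hget := Primrec.list_getD ([] : List ℕ)
    have hget0 := Primrec.list_getD 0
    have hout {x : ((ℕ × ℕ) × List (List ℕ)) × ℕ → ℕ} (hx : Primrec x) :
        Primrec fun q => 6 * x q + q.1.2.length % 6 :=
      Primrec.nat_add.comp (Primrec.nat_mul.comp (Primrec.const 6) hx) hm
    exact Primrec.to₂ <| Primrec.ite (Primrec.nat_le.comp hm (Primrec.const 1))
      (hout (Primrec₂.natPair.comp (subTrmCode_primrec.comp (ht.pair hk) hd₁)
        (subTrmCode_primrec.comp (ht.pair hk) hd₂)))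
      (Primrec.ite (Primrec.nat_le.comp hm (Primrec.const 3))
        (hout (Primrec₂.natPair.comp (hget0.comp (hget.comp hl hd₁) hk)
          (hget0.comp (hget.comp hl hd₂) hk)))
        (hout (hget0.comp (hget.comp hl hd) (Primrec.succ.comp hk))))
  · intro p m
    rw [subFmlCode]
    have h₁ := Nat.unpair_left_le (m / 6)
    have h₂ := Nat.unpair_right_le (m / 6)
    simp only [List.length_map, List.length_range, Option.some.injEq]
    refine List.map_congr_left fun k _ => ?_
    split_ifs with h h'
    · rfl
    · simp [List.getD, show (m / 6).unpair.1 < m by omega, show (m / 6).unpair.2 < m by omega]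
    · simp [List.getD, show m / 6 < m by omega]

/-- The code of `A(n̄)`, from the code of `A`. -/
def instCode (m n : ℕ) : ℕ := (subFmlCode ((numeral n).enc, m + 1) m).getD 0 0

theorem instCode_enc (A : Fml) (hA : A.cu 1 = true) (n : ℕ) :
    instCode A.enc n = encF (sInst A hA n) :=
  subFmlCode_enc (numeral n) (A.enc + 1) A 0 (by omega)

theorem instCode_primrec : Primrec₂ instCode :=
  ((Primrec.list_getD 0).comp (subFmlCode_primrec.comp
    ((numeral_enc_primrec.comp Primrec.snd).pair (Primrec.succ.comp Primrec.fst)) Primrec.fst)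
    (Primrec.const 0)).to₂

/-! ### Translation of recursive codes into primitive recursive codes

Every sequent is enlarged by the false literal `0 ≠ 0`.  A vacuous `ω`-inference with main formula
`∀x 0 ≠ 0`, followed by a cut, then repeats a sequent, and such repetitions are inserted
while waiting for a recursive function to return its value. -/

open Nat.Partrec (Code)

/-- The sentence `0 ≠ 0`. -/
def falseLit : Sentence := ⟨.ne .zero .zero, rfl⟩

/-- The sentence `0 = 0`. -/
def trueLit : Sentence := ⟨.eq .zero .zero, rfl⟩

/-- The sentence `∀x 0 ≠ 0`. -/
def allFalse : Sentence := sAll (.ne .zero .zero) rfl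

/-- The sentence `∃x 0 = 0`. -/
def exTrue : Sentence := sEx (.eq .zero .zero) rfl

/-- Index of the premises of a translated `ω`-inference with side formulas `s` and main formula
`∀x m`.  Premise `n` is the translation of the value at `n` (if `b = 0`) or at `b - 1` (if `b ≠ 0`)
of the function with index `e`, searched for from stage `k` on. -/
def premIndex (c : Code) (s m e b k : ℕ) : ℕ := Encodable.encode (c.curry (tup [s, m, e, b, k]))

/-- A vacuous repetition of the sequent `s`, above which the value of the function with index `e`
at `x` is searched for from stage `k` on. -/
def delayCode (c : Code) (s e x k : ℕ) : ℕ :=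
  tup [cutC, s, encF allFalse,
    tup [omC, s, encF allFalse, premIndex c s falseLit.1.enc e (x + 1) k],
    tup [exC, s, encF exTrue, tup [axC, insertCode (encF trueLit) s]]]

/-- Translation of an immediate subproof of an inference with finitely many premises. -/
def childTrans (c : Code) (a : ℕ) : ℕ :=
  delayCode c (insertCode (encF falseLit) (endCode a)) (Encodable.encode Code.id) a 0

/-- Translation of a coded proof. -/
def nodeTrans (c : Code) (v : ℕ) : ℕ :=
  if proj v 0 = axC then tup [axC, insertCode (encF falseLit) (proj v 1)]
  else if proj v 0 = omC then
    tup [omC, insertCode (encF falseLit) (proj v 1), proj v 2,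
      premIndex c (insertCode (encF falseLit) (proj v 1)) (proj v 2 / 6) (proj v 3) 0 0]
  else if proj v 0 = andC ∨ proj v 0 = cutC then
    tup [proj v 0, insertCode (encF falseLit) (proj v 1), proj v 2,
      childTrans c (proj v 3), childTrans c (proj v 4)]
  else tup [proj v 0, insertCode (encF falseLit) (proj v 1), proj v 2, childTrans c (proj v 3)]

/-- Translation of the value of the function with index `e` at `x`, if it is found at stage `k`,
and a vacuous repetition of the sequent `s` otherwise. -/
def runTrans (c : Code) (s e x k : ℕ) : ℕ :=
  ((Denumerable.ofNat Code e).evaln k x).casesOn (delayCode c s e x (k + 1)) (nodeTrans c)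

/-- The premises of the translated `ω`-inferences. -/
def premTrans (c : Code) (p : ℕ) : ℕ :=
  runTrans c (insertCode (instCode (proj p.unpair.1 1) p.unpair.2) (proj p.unpair.1 0))
    (proj p.unpair.1 2)
    (if proj p.unpair.1 3 = 0 then p.unpair.2 else proj p.unpair.1 3 - 1) (proj p.unpair.1 4)

section Primrec

variable {α : Type*} [Primcodable α] {c : α → Code} {s m e b k v : α → ℕ}

theorem primrec_tup_two (hs : Primrec s) (hm : Primrec m) : Primrec fun a => tup [s a, m a] :=
  tup_primrec.comp <| Primrec.list_cons.comp hs <| Primrec.list_cons.comp hm <| Primrec.const []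

theorem primrec_tup_four (hs : Primrec s) (hm : Primrec m) (he : Primrec e) (hb : Primrec b) :
    Primrec fun a => tup [s a, m a, e a, b a] :=
  tup_primrec.comp <| Primrec.list_cons.comp hs <| Primrec.list_cons.comp hm <|
    Primrec.list_cons.comp he <| Primrec.list_cons.comp hb <| Primrec.const []

theorem primrec_tup_five (hs : Primrec s) (hm : Primrec m) (he : Primrec e) (hb : Primrec b)
    (hk : Primrec k) : Primrec fun a => tup [s a, m a, e a, b a, k a] :=
  tup_primrec.comp <| Primrec.list_cons.comp hs <| Primrec.list_cons.comp hm <|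
    Primrec.list_cons.comp he <| Primrec.list_cons.comp hb <| Primrec.list_cons.comp hk <|
    Primrec.const []

theorem primrec_proj (hv : Primrec v) (i : ℕ) : Primrec fun a => proj (v a) i :=
  proj_primrec.comp hv (Primrec.const i)

theorem primrec_premIndex (hc : Primrec c) (hs : Primrec s) (hm : Primrec m) (he : Primrec e)
    (hb : Primrec b) (hk : Primrec k) :
    Primrec fun a => premIndex (c a) (s a) (m a) (e a) (b a) (k a) :=
  Primrec.encode.comp (Code.primrec₂_curry.comp hc (primrec_tup_five hs hm he hb hk))

theorem primrec_delayCode (hc : Primrec c) (hs : Primrec s) (he : Primrec e) (hb : Primrec b)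
    (hk : Primrec k) : Primrec fun a => delayCode (c a) (s a) (e a) (b a) (k a) :=
  primrec_tup_five (Primrec.const _) hs (Primrec.const _)
    (primrec_tup_four (Primrec.const _) hs (Primrec.const _)
      (primrec_premIndex hc hs (Primrec.const _) he (Primrec.succ.comp hb) hk))
    (primrec_tup_four (Primrec.const _) hs (Primrec.const _)
      (primrec_tup_two (Primrec.const _) (insertCode_primrec.comp (Primrec.const _) hs)))

theorem primrec_childTrans (hc : Primrec c) (hv : Primrec v) :
    Primrec fun a => childTrans (c a) (v a) :=
  primrec_delayCode hc (insertCode_primrec.comp (Primrec.const _) (endCode_primrec.comp hv))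
    (Primrec.const _) hv (Primrec.const 0)

theorem primrec_nodeTrans (hc : Primrec c) (hv : Primrec v) :
    Primrec fun a => nodeTrans (c a) (v a) := by
  have hp := primrec_proj hv
  have he (i : ℕ) : PrimrecPred fun a => proj (v a) 0 = i :=
    Primrec.eq.comp (hp 0) (Primrec.const i)
  have hs : Primrec fun a => insertCode (encF falseLit) (proj (v a) 1) :=
    insertCode_primrec.comp (Primrec.const _) (hp 1)
  exact Primrec.ite (he _) (primrec_tup_two (Primrec.const _) hs)
    (Primrec.ite (he _) (primrec_tup_four (Primrec.const _) hs (hp 2)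
        (primrec_premIndex hc hs (Primrec.nat_div.comp (hp 2) (Primrec.const 6)) (hp 3)
          (Primrec.const 0) (Primrec.const 0)))
      (Primrec.ite ((he _).or (he _))
        (primrec_tup_five (hp 0) hs (hp 2) (primrec_childTrans hc (hp 3))
          (primrec_childTrans hc (hp 4)))
        (primrec_tup_four (hp 0) hs (hp 2) (primrec_childTrans hc (hp 3)))))

theorem primrec_runTrans (hc : Primrec c) (hs : Primrec s) (he : Primrec e) (hb : Primrec b)
    (hk : Primrec k) : Primrec fun a => runTrans (c a) (s a) (e a) (b a) (k a) :=
  Primrec.option_casesOn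
    (Code.primrec_evaln.comp ((hk.pair ((Primrec.ofNat Code).comp he)).pair hb))
    (primrec_delayCode hc hs he hb (Primrec.succ.comp hk))
    (primrec_nodeTrans (hc.comp Primrec.fst) Primrec.snd).to₂

theorem primrec_premTrans (hc : Primrec c) (hv : Primrec v) :
    Primrec fun a => premTrans (c a) (v a) := by
  have hst := Primrec.fst.comp (Primrec.unpair.comp hv)
  have hn := Primrec.snd.comp (Primrec.unpair.comp hv)
  have hp := primrec_proj hst
  exact primrec_runTrans hc
    (insertCode_primrec.comp (instCode_primrec.comp (hp 1) hn) (hp 0)) (hp 2)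
    (Primrec.ite (Primrec.eq.comp (hp 3) (Primrec.const 0)) hn
      (Primrec.nat_sub.comp (hp 3) (Primrec.const 1))) (hp 4)

end Primrec

theorem exists_code_premTrans : ∃ c : Code, ∀ p, c.eval p = Part.some (premTrans c p) := by
  obtain ⟨c, hc⟩ := Code.fixed_point₂ (f := fun c p => Part.some (premTrans c p))
    (primrec_premTrans Primrec.fst Primrec.snd).to_comp.partrec
  exact ⟨c, fun p => by rw [hc]⟩

/-! ### Correctness of the translation -/

/-- `a` is a primitive recursive code of a proof of `Γ`. -/
def PrecProof (a : ℕ) (Γ : Finset Sentence) : Prop := Cprec a ∧ EndS a = Γ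

theorem PrecProof.ax {Γ : Finset Sentence} (h : IsAxiom Γ) : PrecProof (tup [axC, encS Γ]) Γ :=
  ⟨.ax Γ h, by simp [EndS, proj_tup, decS_encS]⟩

theorem PrecProof.and {a b : ℕ} {Γ : Finset Sentence} {A B : Sentence}
    (ha : PrecProof a (insert A Γ)) (hb : PrecProof b (insert B Γ)) :
    PrecProof (tup [andC, encS Γ, encF (sAnd A B), a, b]) (insert (sAnd A B) Γ) :=
  ⟨.and Γ A B ha.1 hb.1 (by simp [ha.2]) (by simp [hb.2]),
    by simp [EndS, proj_tup, decS_encS, decF_encF, andC, cutC, axC, omrepC]⟩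

theorem PrecProof.or {a : ℕ} {Γ : Finset Sentence} {A B : Sentence}
    (ha : PrecProof a (insert A (insert B Γ))) :
    PrecProof (tup [orC, encS Γ, encF (sOr A B), a]) (insert (sOr A B) Γ) :=
  ⟨.or Γ A B ha.1 (by simp [ha.2]),
    by simp [EndS, proj_tup, decS_encS, decF_encF, orC, cutC, axC, omrepC]⟩

theorem PrecProof.ex {a : ℕ} {Γ : Finset Sentence} {A : Fml} {hA : A.cu 1 = true} {n : ℕ}
    (ha : PrecProof a (insert (sInst A hA n) Γ)) :
    PrecProof (tup [exC, encS Γ, encF (sEx A hA), a]) (insert (sEx A hA) Γ) :=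
  ⟨.ex Γ A hA n ha.1 (by simp [ha.2]),
    by simp [EndS, proj_tup, decS_encS, decF_encF, exC, cutC, axC, omrepC]⟩

theorem PrecProof.cut {a b : ℕ} {Γ : Finset Sentence} {C : Sentence}
    (ha : PrecProof a (insert C Γ)) (hb : PrecProof b (insert (sNeg C) Γ)) :
    PrecProof (tup [cutC, encS Γ, encF C, a, b]) Γ :=
  ⟨.cut rfl Γ C ha.1 hb.1 (by simp [ha.2]) (by simp [hb.2]), by simp [EndS, proj_tup, decS_encS]⟩

theorem PrecProof.om {e : ℕ} {Γ : Finset Sentence} {A : Fml} {hA : A.cu 1 = true} {f : ℕ → ℕ}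
    (hf : Nat.Primrec f) (he : ∀ n, peval e n = Part.some (f n))
    (h : ∀ n, PrecProof (f n) (insert (sInst A hA n) Γ)) :
    PrecProof (tup [omC, encS Γ, encF (sAll A hA), e]) (insert (sAll A hA) Γ) := by
  have htot : ∀ n, (peval e n).Dom := fun n => by rw [he]; trivial
  have hget : ∀ n, (peval e n).get (htot n) = f n := fun n => by simp [he]
  refine ⟨.om Γ A hA (fun _ => ⟨f, hf, he⟩) htot (fun n => ?_) fun n => ?_, ?_⟩
  · rw [hget]; exact (h n).1
  · rw [hget, (h n).2]; simp
  · simp [EndS, proj_tup, decS_encS, decF_encF, omC, cutC, axC, omrepC]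

theorem PrecProof.om_premIndex {c : Code} (hc : ∀ p, c.eval p = Part.some (premTrans c p))
    {Γ : Finset Sentence} {A : Fml} {hA : A.cu 1 = true} {e b k : ℕ}
    (h : ∀ n, PrecProof (runTrans c (encS (insert (sInst A hA n) Γ)) e
      (if b = 0 then n else b - 1) k) (insert (sInst A hA n) Γ)) :
    PrecProof (tup [omC, encS Γ, encF (sAll A hA), premIndex c (encS Γ) A.enc e b k])
      (insert (sAll A hA) Γ) := by
  refine PrecProof.om (f := fun n => premTrans c (Nat.pair (tup [encS Γ, A.enc, e, b, k]) n))
    ?_ (fun n => ?_) fun n => ?_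
  · exact Primrec.nat_iff.1 (primrec_premTrans (Primrec.const c)
      (Primrec₂.natPair.comp (Primrec.const _) Primrec.id))
  · simp [peval, premIndex, hc]
  · simpa [premTrans, proj_tup, instCode_enc A hA, insertCode_encS] using h n

theorem PrecProof.delayCode {c : Code} (hc : ∀ p, c.eval p = Part.some (premTrans c p))
    {Γ : Finset Sentence} (hΓ : falseLit ∈ Γ) {e x k : ℕ}
    (h : PrecProof (runTrans c (encS Γ) e x k) Γ) :
    PrecProof (delayCode c (encS Γ) e x k) Γ := by
  refine PrecProof.cut (C := allFalse) (PrecProof.om_premIndex hc fun n => ?_) ?_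
  · have hn : insert (sInst (.ne .zero .zero) rfl n) Γ = Γ := Finset.insert_eq_of_mem hΓ
    simpa [hn] using h
  · rw [insertCode_encS]
    exact PrecProof.ex (n := 0) (PrecProof.ax ⟨trueLit, Finset.mem_insert_self _ _, rfl, rfl⟩)

theorem PrecProof.runTrans {c : Code} (hc : ∀ p, c.eval p = Part.some (premTrans c p))
    {Γ : Finset Sentence} (hΓ : falseLit ∈ Γ) {e x v : ℕ}
    (hv : v ∈ peval e x) (h : PrecProof (nodeTrans c v) Γ) (k : ℕ) :
    PrecProof (runTrans c (encS Γ) e x k) Γ := by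
  obtain ⟨k₀, hk₀⟩ := Code.evaln_complete.1 hv
  induction hd : k₀ - k generalizing k with
  | zero =>
    have hk : (Denumerable.ofNat Code e).evaln k x = some v :=
      Code.evaln_mono (by omega) hk₀
    simpa [Shoen.runTrans, hk] using h
  | succ d ih =>
    cases hk : (Denumerable.ofNat Code e).evaln k x with
    | none => simpa [Shoen.runTrans, hk] using PrecProof.delayCode hc hΓ (ih (k + 1) (by omega))
    | some w =>
      have hw : w = v := Part.mem_unique (Code.evaln_sound hk) hv
      simpa [Shoen.runTrans, hk, hw] using h

theorem PrecProof.childTrans {c : Code} (hc : ∀ p, c.eval p = Part.some (premTrans c p))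
    {a : ℕ} (ha : Crec a)
    (h : PrecProof (nodeTrans c a) (insert falseLit (EndS a))) :
    PrecProof (childTrans c a) (insert falseLit (EndS a)) := by
  have hΓ := Finset.mem_insert_self falseLit (EndS a)
  rw [Shoen.childTrans, endCode_eq ha, insertCode_encS]
  refine PrecProof.delayCode hc hΓ (PrecProof.runTrans hc hΓ (v := a) ?_ h 0)
  simp [peval]

theorem PrecProof.nodeTrans {c : Code} (hc : ∀ p, c.eval p = Part.some (premTrans c p))
    {a : ℕ} (ha : Crec a) :
    PrecProof (nodeTrans c a) (insert falseLit (EndS a)) := by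
  induction ha with
  | ax Γ h =>
    have h' : IsAxiom (insert falseLit Γ) := by
      obtain ⟨A, hA, hlit⟩ := h
      exact ⟨A, Finset.mem_insert_of_mem hA, hlit⟩
    simpa [Shoen.nodeTrans, EndS, proj_tup, decS_encS, insertCode_encS] using PrecProof.ax h'
  | and Γ A B ha hb ea eb iha ihb =>
    have ha' := PrecProof.childTrans hc ha iha
    have hb' := PrecProof.childTrans hc hb ihb
    rw [ea, Finset.union_singleton, Finset.insert_comm] at ha'
    rw [eb, Finset.union_singleton, Finset.insert_comm] at hb'
    simpa [Shoen.nodeTrans, EndS, proj_tup, decS_encS, decF_encF, insertCode_encS, axC, andC, omC,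
      cutC, omrepC, Finset.insert_comm falseLit] using ha'.and hb'
  | or Γ A B ha ea iha =>
    have ha' := PrecProof.childTrans hc ha iha
    rw [ea, show insert falseLit (Γ ∪ {A, B}) = insert A (insert B (insert falseLit Γ)) by
      ext; simp; tauto] at ha'
    simpa [Shoen.nodeTrans, EndS, proj_tup, decS_encS, decF_encF, insertCode_encS, axC, andC, omC,
      orC, cutC, omrepC, Finset.insert_comm falseLit] using ha'.or
  | @om e Γ A hA hp htot hmem hend ih =>
    have h := PrecProof.om_premIndex hc (Γ := insert falseLit Γ) (A := A) (hA := hA) (e := e)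
      (b := 0) (k := 0) fun n => by
        have h := ih n
        rw [hend, Finset.union_singleton, Finset.insert_comm] at h
        exact PrecProof.runTrans hc (by simp) (Part.get_mem (htot n)) h 0
    have hdiv : encF (sAll A hA) / 6 = A.enc := by
      change (6 * A.enc + 4) / 6 = A.enc
      omega
    simpa [Shoen.nodeTrans, EndS, proj_tup, decS_encS, decF_encF, insertCode_encS, axC, omC,
      cutC, omrepC, hdiv, Finset.insert_comm falseLit] using h
  | ex Γ A hA n ha ea iha =>
    have ha' := PrecProof.childTrans hc ha iha
    rw [ea, Finset.union_singleton, Finset.insert_comm] at ha'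
    simpa [Shoen.nodeTrans, EndS, proj_tup, decS_encS, decF_encF, insertCode_encS, axC, andC, omC,
      exC, cutC, omrepC, Finset.insert_comm falseLit] using ha'.ex
  | cut _ Γ C ha hb ea eb iha ihb =>
    have ha' := PrecProof.childTrans hc ha iha
    have hb' := PrecProof.childTrans hc hb ihb
    rw [ea, Finset.union_singleton, Finset.insert_comm] at ha'
    rw [eb, Finset.union_singleton, Finset.insert_comm] at hb'
    simpa [Shoen.nodeTrans, EndS, proj_tup, decS_encS, insertCode_encS, axC, andC, omC,
      cutC, omrepC] using ha'.cut hb'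
  | omrep hr => cases hr

theorem Crec_of_Cprec {a : ℕ} (ha : Cprec a) : Crec a := by
  induction ha with
  | ax Γ h => exact .ax Γ h
  | and Γ A B _ _ ea eb iha ihb => exact .and Γ A B iha ihb ea eb
  | or Γ A B _ ea iha => exact .or Γ A B iha ea
  | om Γ A hA _ htot _ hend ih => exact .om Γ A hA nofun htot ih hend
  | ex Γ A hA n _ ea iha => exact .ex Γ A hA n iha ea
  | cut hc Γ C _ _ ea eb iha ihb => exact .cut hc Γ C iha ihb ea eb
  | omrep hr => cases hr

/-- `thm(C_prec) = thm(C_rec)`. -/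
theorem thm_cprec_eq_thm_crec (A : Sentence) :
    (∃ a : ℕ, Cprec a ∧ EndS a = {A}) ↔ (∃ a : ℕ, Crec a ∧ EndS a = {A}) := by
  refine ⟨fun ⟨a, ha, hA⟩ => ⟨a, Crec_of_Cprec ha, hA⟩, fun ⟨a, ha, hA⟩ => ?_⟩
  obtain ⟨c, hc⟩ := exists_code_premTrans
  have h := PrecProof.nodeTrans hc ha
  rw [hA] at h
  exact ⟨_, PrecProof.cut (C := falseLit) h
    (PrecProof.ax ⟨trueLit, Finset.mem_insert_self _ _, rfl, rfl⟩)⟩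

end Shoen
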